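/- Superposition of all 3-SAT solutions: let ψ := 2^{−n/2}·Σ_{x ∈ X} |x⟩ be the uniform superposition, let S := {x ∈ X : Cⱼ(x) = true for all j ∈ Fin N} be the (assumed nonempty) solution set with N_s := |S|, and let ē ∈ Fin N → Bool be the all-true ancilla state. Then as t → ∞, (I ⊗ |ē⟩⟨ē|) · E_t(|ψ⟩⟨ψ| ⊗ |1̄⟩⟨1̄|) · (I ⊗ |ē⟩⟨ē|) converges to (N_s / 2^n) · |S⟩⟨S| ⊗ |ē⟩⟨ē|, where |S⟩ := N_s^{−1/2}·Σ_{s ∈ S} |s⟩ is the uniform superposition of all solutions of the 3-SAT formula. -/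

import Mathlib

open Matrix Filter
open scoped Kronecker Topology

attribute [local instance] Matrix.normedAddCommGroup Matrix.normedSpace

noncomputable section

/-- The computational basis of `n` qubits, `X = {0,1}ⁿ`. -/
abbrev QubitBasis (n : ℕ) := Fin n → Bool

/-- Evaluation of the 3-literal clause with indices `i₁ i₂ i₃` and bits `b₁ b₂ b₃`:
`C(x) = ¬(x i₁ = b₁ ∧ x i₂ = b₂ ∧ x i₃ = b₃)`. -/
def clauseEval {n : ℕ} (i₁ i₂ i₃ : Fin n) (b₁ b₂ b₃ : Bool) (x : QubitBasis n) : Bool :=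
  ! (decide (x i₁ = b₁) && decide (x i₂ = b₂) && decide (x i₃ = b₃))

/-- The Lindblad operator `Lⱼ` attached to the `j`-th clause of an `N`-clause network:
`Lⱼ((x,ā),(y,b̄)) = 1` iff `x = y`, `Cⱼ(x) = false`, `ā j = false`, `b̄ j = true`, and
`ā k = b̄ k` for all `k ≠ j`. -/
def jumpOpN {n N : ℕ} (C : Fin N → QubitBasis n → Bool) (j : Fin N) :
    Matrix (QubitBasis n × (Fin N → Bool)) (QubitBasis n × (Fin N → Bool)) ℂ :=
  Matrix.of fun p q =>
    if p.1 = q.1 ∧ C j p.1 = false ∧ p.2 j = false ∧ q.2 j = true ∧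
        (∀ k, k ≠ j → p.2 k = q.2 k) then 1 else 0

/-- The Lindbladian `ℒ(ρ) = γ (L ρ L† − (1/2)(L†L ρ + ρ L†L))` as a linear endomorphism
of the matrix space. -/
def lindbladian {d : Type*} [Fintype d] [DecidableEq d] (γ : ℝ) (L : Matrix d d ℂ) :
    Matrix d d ℂ →ₗ[ℂ] Matrix d d ℂ :=
  (γ : ℂ) • ((LinearMap.mulRight ℂ Lᴴ).comp (LinearMap.mulLeft ℂ L)
    - (1 / 2 : ℂ) • (LinearMap.mulLeft ℂ (Lᴴ * L) + LinearMap.mulRight ℂ (Lᴴ * L)))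

/-- The evolution `E_t = exp(t·ℒ)`, the exponential of the endomorphism `ℒ`. -/
def evol {d : Type*} [Fintype d] [DecidableEq d]
    (L : Matrix d d ℂ →ₗ[ℂ] Matrix d d ℂ) (t : ℝ) :
    Matrix d d ℂ →L[ℂ] Matrix d d ℂ :=
  haveI : IsTopologicalRing (Matrix d d ℂ →L[ℂ] Matrix d d ℂ) :=
    @NonUnitalSeminormedRing.toIsTopologicalRing (Matrix d d ℂ →L[ℂ] Matrix d d ℂ)
      (ContinuousLinearMap.toNormedRing (𝕜 := ℂ)
        (E := Matrix d d ℂ)).toNonUnitalNormedRing.toNonUnitalSeminormedRing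
  NormedSpace.exp ((t : ℂ) • LinearMap.toContinuousLinearMap L)


theorem aux_exp {E : Type*} [NormedAddCommGroup E] [NormedSpace ℂ E] [CompleteSpace E]
    (A : E →L[ℂ] E) (f : E →L[ℂ] ℂ) (c : ℂ) (h : ∀ v, f (A v) = c * f v) (v : E) :
    f (NormedSpace.exp A v) = Complex.exp c * f v := by
  have hk : ∀ k : ℕ, ∀ v, f ((A ^ k) v) = c ^ k * f v := by
    intro k
    induction k with
    | zero => intro v; simp
    | succ k ih =>
      intro v
      rw [pow_succ, mul_apply_eq_comp]
      rw [ih, h]; ring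
  have h1 := NormedSpace.exp_series_hasSum_exp' (𝕂 := ℂ) A
  have h2 := (f.comp (ContinuousLinearMap.apply ℂ E v)).hasSum h1
  have h3 := (NormedSpace.exp_series_hasSum_exp' (𝕂 := ℂ) c).mul_right (f v)
  rw [← Complex.exp_eq_exp_ℂ] at h3
  refine h2.unique ?_
  refine Eq.mp (congrArg (fun g => HasSum g _) (funext fun k => ?_)) h3
  symm
  change f (((k.factorial : ℂ)⁻¹ • A ^ k) v) = _
  rw [ContinuousLinearMap.smul_apply, map_smul, hk, smul_eq_mul, smul_eq_mul]
  ring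

theorem aux_evol {d : Type*} [Fintype d] [DecidableEq d]
    (L : Matrix d d ℂ →ₗ[ℂ] Matrix d d ℂ) (t : ℝ) (p q : d) (c : ℂ)
    (h : ∀ ρ, L ρ p q = c * ρ p q) (ρ : Matrix d d ℂ) :
    evol L t ρ p q = Complex.exp (t * c) * ρ p q := by
  have := aux_exp ((t : ℂ) • LinearMap.toContinuousLinearMap L)
    (LinearMap.toContinuousLinearMap (Matrix.entryLinearMap ℂ ℂ p q)) (t * c)
    (by
      intro v
      change (t : ℂ) * L v p q = t * c * v p q
      rw [h]; ring) ρ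
  exact this

theorem jump_row {n N : ℕ} (C : Fin N → QubitBasis n → Bool) (j : Fin N) (x : QubitBasis n)
    (q : QubitBasis n × (Fin N → Bool)) : jumpOpN C j (x, fun _ : Fin N => true) q = 0 := by
  simp [jumpOpN]

theorem jump_sq {n N : ℕ} (C : Fin N → QubitBasis n → Bool) (j : Fin N) :
    (jumpOpN C j)ᴴ * jumpOpN C j =
      Matrix.diagonal fun p => if C j p.1 = false ∧ p.2 j = true then (1 : ℂ) else 0 := by
  ext p q
  rw [Matrix.mul_apply, Finset.sum_eq_single (p.1, Function.update p.2 j false)]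
  · obtain ⟨x, a⟩ := p
    obtain ⟨y, b⟩ := q
    have e1 : ∀ k, k ≠ j → Function.update a j false k = a k := by
      intro k hk; simp [hk]
    have e2 : (x = y ∧ a j = true ∧ b j = true ∧ ∀ k, k ≠ j → a k = b k) ↔
        ((x, a) = (y, b) ∧ a j = true) := by
      constructor
      · rintro ⟨rfl, h1, h2, h3⟩
        refine ⟨?_, h1⟩
        congr 1
        funext k
        by_cases hk : k = j
        · rw [hk, h1, h2]
        · exact h3 k hk
      · rintro ⟨h, h1⟩
        cases h
        simp [h1]
    have e3 : (∀ k, k ≠ j → Function.update a j false k = b k) ↔ (∀ k, k ≠ j → a k = b k) := by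
      refine forall_congr' fun k => forall_congr' fun hk => ?_
      rw [e1 k hk]
    have e4 : ∀ k, k ≠ j → Function.update a j false k = a k := e1
    simp only [jumpOpN, Matrix.conjTranspose_apply, Matrix.of_apply, Matrix.diagonal_apply, e3,
      Function.update_self]
    by_cases hc : C j x = false <;> by_cases ha : a j = true
    · by_cases hq : (x, a) = (y, b)
      · have := e2.2 ⟨hq, ha⟩
        rw [if_pos ⟨trivial, hc, trivial, ha, e4⟩, if_pos ⟨this.1, hc, trivial, this.2.2⟩, if_pos hq,
          if_pos ⟨hc, ha⟩]
        simp
      · rw [if_neg (c := x = y ∧ _), if_neg hq]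
        · simp
        · rintro ⟨h1, -, -, h2⟩
          exact hq (e2.1 ⟨h1, ha, h2⟩).1
    all_goals simp [hc, ha]
  · rintro ⟨z, c⟩ - hz
    rw [Matrix.conjTranspose_apply]
    have : jumpOpN C j (z, c) p = 0 := by
      simp only [jumpOpN, Matrix.of_apply]
      rw [if_neg]
      rintro ⟨h1, -, h2, -, h3⟩
      apply hz
      change z = p.1 at h1
      change c j = false at h2
      change ∀ k, k ≠ j → c k = p.2 k at h3
      rw [h1]
      congr 1
      funext k
      by_cases hk : k = j
      · rw [hk]; simpa using h2
      · simpa [hk] using h3 k hk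
    simp [this]
  · simp

theorem lind_entry {n N : ℕ} (C : Fin N → QubitBasis n → Bool) (γ : ℝ) (x y : QubitBasis n)
    (ρ : Matrix (QubitBasis n × (Fin N → Bool)) (QubitBasis n × (Fin N → Bool)) ℂ) :
    (∑ j, lindbladian γ (jumpOpN C j)) ρ (x, fun _ : Fin N => true) (y, fun _ : Fin N => true) =
      ((-(γ / 2 * ∑ j, ((if C j x = false then (1 : ℝ) else 0) +
        (if C j y = false then (1 : ℝ) else 0))) : ℝ) : ℂ) *
        ρ (x, fun _ : Fin N => true) (y, fun _ => true) := by
  rw [LinearMap.sum_apply, Matrix.sum_apply]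
  push_cast
  rw [Finset.mul_sum, ← Finset.sum_neg_distrib, Finset.sum_mul]
  refine Finset.sum_congr rfl fun j _ => ?_
  have h0 : (jumpOpN C j * ρ * (jumpOpN C j)ᴴ) (x, fun _ : Fin N => true) (y, fun _ : Fin N => true) = 0 := by
    rw [Matrix.mul_apply]
    refine Finset.sum_eq_zero fun q _ => ?_
    rw [Matrix.conjTranspose_apply, jump_row]
    simp
  simp only [lindbladian, jump_sq, LinearMap.smul_apply, LinearMap.sub_apply, LinearMap.add_apply,
    LinearMap.comp_apply, LinearMap.mulLeft_apply, LinearMap.mulRight_apply, Matrix.smul_apply,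
    Matrix.sub_apply, Matrix.add_apply, h0, Matrix.diagonal_mul, Matrix.mul_diagonal, smul_eq_mul]
  by_cases h1 : C j x = false <;> by_cases h2 : C j y = false <;> simp [h1, h2] <;> ring

theorem Pe_sandwich {X A : Type*} [Fintype X] [DecidableEq X] [Fintype A] [DecidableEq A] (e : A)
    (M : Matrix (X × A) (X × A) ℂ) (p q : X × A) :
    (((1 : Matrix X X ℂ) ⊗ₖ Matrix.single e e (1 : ℂ)) * M *
      ((1 : Matrix X X ℂ) ⊗ₖ Matrix.single e e (1 : ℂ))) p q =
      if p.2 = e ∧ q.2 = e then M (p.1, e) (q.1, e) else 0 := by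
  have hd : ((1 : Matrix X X ℂ) ⊗ₖ Matrix.single e e (1 : ℂ)) =
      Matrix.diagonal fun p : X × A => if p.2 = e then (1 : ℂ) else 0 := by
    rw [← Matrix.diagonal_single, ← Matrix.diagonal_one, Matrix.diagonal_kronecker_diagonal]
    congr 1
    funext p
    simp [Pi.single_apply]
  rw [hd, Matrix.mul_diagonal, Matrix.diagonal_mul]
  obtain ⟨x, a⟩ := p
  obtain ⟨y, b⟩ := q
  by_cases ha : a = e <;> by_cases hb : b = e <;> simp [ha, hb]

/-- starting from the uniform superposition, post-selecting the
all-`1` ancilla outcome `|ē⟩` yields (in the `t → ∞` limit) the uniform superposition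
`|S⟩` of all solutions of the 3-SAT formula, with weight `N_s/2ⁿ`. -/
theorem sat_solution_superposition {n N : ℕ} (hn : 1 ≤ n) (hN : 1 ≤ N)
    (i₁ i₂ i₃ : Fin N → Fin n)
    (h₁₂ : ∀ j, i₁ j ≠ i₂ j) (h₁₃ : ∀ j, i₁ j ≠ i₃ j) (h₂₃ : ∀ j, i₂ j ≠ i₃ j)
    (b₁ b₂ b₃ : Fin N → Bool) (γ : ℝ) (hγ : 0 < γ)
    (C : Fin N → QubitBasis n → Bool)
    (hC : ∀ j, C j = clauseEval (i₁ j) (i₂ j) (i₃ j) (b₁ j) (b₂ j) (b₃ j))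
    (S : Finset (QubitBasis n))
    (hS : S = {x : QubitBasis n | ∀ j, C j x = true})
    (hSne : S.Nonempty)
    (ψ : QubitBasis n → ℂ) (hψ : ψ = fun _ => ((Real.sqrt (2 ^ n) : ℝ) : ℂ)⁻¹)
    (vS : QubitBasis n → ℂ)
    (hvS : vS = fun x => if x ∈ S then ((Real.sqrt S.card : ℝ) : ℂ)⁻¹ else 0)
    (Pe : Matrix (QubitBasis n × (Fin N → Bool)) (QubitBasis n × (Fin N → Bool)) ℂ)
    (hPe : Pe = (1 : Matrix (QubitBasis n) (QubitBasis n) ℂ) ⊗ₖ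
      Matrix.single (fun _ => true) (fun _ => true) (1 : ℂ)) :
    Tendsto
      (fun t : ℝ => Pe *
        evol (∑ j, lindbladian γ (jumpOpN C j)) t
          (Matrix.vecMulVec ψ (star ψ) ⊗ₖ
            Matrix.single (fun _ => true) (fun _ => true) (1 : ℂ)) * Pe)
      atTop
      (𝓝 (((S.card : ℂ) / 2 ^ n) •
        (Matrix.vecMulVec vS (star vS) ⊗ₖ
          Matrix.single (fun _ => true) (fun _ => true) (1 : ℂ)))) := by
  subst hPe
  refine tendsto_pi_nhds.2 ?_
  intro p
  refine tendsto_pi_nhds.2 ?_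
  intro q
  obtain ⟨x, a⟩ := p
  obtain ⟨y, b⟩ := q
  simp only [Pe_sandwich]
  by_cases hab : a = (fun _ => true) ∧ b = (fun _ => true)
  swap
  · rw [not_and_or] at hab
    have : ¬ ((fun _ => true) = a ∧ (fun _ => true) = b) := by
      rintro ⟨h1, h2⟩
      rcases hab with h | h
      · exact h h1.symm
      · exact h h2.symm
    have h' : ¬ (a = (fun _ => true) ∧ b = (fun _ => true)) := by tauto
    simp only [if_neg h']
    simp [Matrix.single_apply, this]
  obtain ⟨rfl, rfl⟩ := hab
  simp only [and_self, if_true]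
  simp only [aux_evol _ _ _ _ _ (fun ρ => lind_entry C γ x y ρ)]
  have hmem : ∀ x, x ∈ S ↔ ∀ j, C j x = true := by
    intro x
    rw [← Finset.mem_coe, hS]
    rfl
  set s : ℝ := ∑ j, ((if C j x = false then (1 : ℝ) else 0) +
        (if C j y = false then (1 : ℝ) else 0)) with hs
  have hψ2 : ∀ x y, ψ x * star ψ y = ((2 : ℂ) ^ n)⁻¹ := by
    intro x y
    have : ((Real.sqrt (2 ^ n) : ℝ) : ℂ) * ((Real.sqrt (2 ^ n) : ℝ) : ℂ) = 2 ^ n := by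
      rw [← Complex.ofReal_mul, Real.mul_self_sqrt (by positivity)]
      push_cast; rfl
    rw [hψ, ← this]
    simp
  have hterm : (Matrix.vecMulVec ψ (star ψ) ⊗ₖ
      Matrix.single (fun _ : Fin N => true) (fun _ => true) (1 : ℂ)) (x, fun _ : Fin N => true)
        (y, fun _ : Fin N => true) = ((2 : ℂ) ^ n)⁻¹ := by
    simp only [Matrix.kroneckerMap_apply, Matrix.vecMulVec_apply, hψ2, Matrix.single_apply_same,
      mul_one]
  rw [hterm]
  have hnn : ∀ j, 0 ≤ ((if C j x = false then (1 : ℝ) else 0) +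
        (if C j y = false then (1 : ℝ) else 0)) := by
    intro j; positivity
  by_cases hxy : x ∈ S ∧ y ∈ S
  · have hx := (hmem x).1 hxy.1
    have hy := (hmem y).1 hxy.2
    have hs0 : s = 0 := by simp [hs, hx, hy]
    rw [hs0]
    have hc : ((Real.sqrt S.card : ℝ) : ℂ) * ((Real.sqrt S.card : ℝ) : ℂ) = S.card := by
      rw [← Complex.ofReal_mul, Real.mul_self_sqrt (by positivity)]
      push_cast; rfl
    have hc0 : (S.card : ℂ) ≠ 0 := by
      exact_mod_cast hSne.card_pos.ne'
    have : (((S.card : ℂ) / 2 ^ n) • (Matrix.vecMulVec vS (star vS) ⊗ₖ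
        Matrix.single (fun _ : Fin N => true) (fun _ => true) (1 : ℂ))) (x, fun _ : Fin N => true)
        (y, fun _ : Fin N => true) = ((2 : ℂ) ^ n)⁻¹ := by
      have hv : vS x * star vS y = (S.card : ℂ)⁻¹ := by
        rw [← hc, hvS]
        simp [hxy.1, hxy.2]
      simp only [Matrix.smul_apply, Matrix.kroneckerMap_apply, Matrix.vecMulVec_apply, hv,
        Matrix.single_apply_same, mul_one, smul_eq_mul]
      field_simp
    rw [this]
    simp
  · have hspos : 0 < s := by
      have : ∃ j, C j x = false ∨ C j y = false := by
        by_contra hne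
        push Not at hne
        apply hxy
        rw [hmem, hmem]
        exact ⟨fun j => by simpa using (hne j).1, fun j => by simpa using (hne j).2⟩
      obtain ⟨j, hj⟩ := this
      refine Finset.sum_pos' (fun j _ => hnn j) ⟨j, Finset.mem_univ _, ?_⟩
      rcases hj with h | h
      · rw [if_pos h]; positivity
      · rw [if_pos h]; positivity
    have hv : vS x * star vS y = 0 := by
      rw [hvS]
      rw [not_and_or] at hxy
      rcases hxy with h | h <;> simp [h]
    have : (((S.card : ℂ) / 2 ^ n) • (Matrix.vecMulVec vS (star vS) ⊗ₖ
        Matrix.single (fun _ : Fin N => true) (fun _ => true) (1 : ℂ))) (x, fun _ : Fin N => true)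
        (y, fun _ : Fin N => true) = 0 * ((2 : ℂ) ^ n)⁻¹ := by
      simp only [Matrix.smul_apply, Matrix.kroneckerMap_apply, Matrix.vecMulVec_apply, hv,
        zero_mul, smul_zero]
    rw [this]
    refine Tendsto.mul_const _ ?_
    have hr : Tendsto (fun t : ℝ => Real.exp (t * -(γ / 2 * s))) atTop (𝓝 0) := by
      refine Real.tendsto_exp_atBot.comp ?_
      exact tendsto_id.atTop_mul_const_of_neg (by
        have : 0 < γ / 2 * s := by positivity
        linarith)
    have := (Complex.continuous_ofReal.tendsto 0).comp hr
    simpa [Function.comp_def] using this
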